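/- Let n ≥ 1, let q, λ, μ ∈ ℂ with q nonzero and not a root of unity, λ ≠ 0, μ ≠ 0, and let β, κ ∈ ℤ_{≥0}^n with κ ≤ β, (μ;q)_{|β|} ≠ 0 and (λ;q)_{|β|} ≠ 0. Then Σ_{γ ∈ ℤ_{≥0}^n, κ ≤ γ ≤ β} Φ_q^{(n)}(γ|β;λ,μ) · Φ_q^{(n)}(κ|γ;μ,λ) equals 1 if κ = β and equals 0 otherwise. (This is the component form of the inversion relation Š(λ,μ)Š(μ,λ) = id for the stochastic R matrix.) -/

import Mathlib

/-- The q-Pochhammer symbol `(z;q)_m = ∏_{j=0}^{m-1} (1 - z q^j)`. -/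
noncomputable def qPoch (q z : ℂ) (m : ℕ) : ℂ := ∏ j ∈ Finset.range m, (1 - z * q ^ j)

/-- The q-binomial coefficient `binom(m,k)_q`. -/
noncomputable def qBinom (q : ℂ) (m k : ℕ) : ℂ :=
  if k ≤ m then qPoch q q m / (qPoch q q k * qPoch q q (m - k)) else 0

/-- `q` is not a root of unity. -/
def notRootOfUnity (q : ℂ) : Prop := ∀ m : ℕ, 0 < m → q ^ m ≠ 1

/-- `φ(β,γ) = Σ_{1 ≤ i < j ≤ k} β_i γ_j` for integer vectors. -/
def phi {k : ℕ} (β γ : Fin k → ℤ) : ℤ :=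
  ∑ i, ∑ j, if i < j then β i * γ j else 0

open Classical in
/-- The weight `Φ_q^{(n)}(γ|β;λ,μ)` of the stochastic R matrix of `U_q(A^{(1)}_n)`. -/
noncomputable def Phi (n : ℕ) (q lam mu : ℂ) (γ β : Fin n → ℕ) : ℂ :=
  if γ ≤ β then
    q ^ phi (fun i => (β i : ℤ) - (γ i : ℤ)) (fun i => (γ i : ℤ))
      * (mu / lam) ^ (∑ i, γ i)
      * qPoch q lam (∑ i, γ i) * qPoch q (mu / lam) ((∑ i, β i) - ∑ i, γ i)
      * (∏ i, qBinom q (β i) (γ i)) / qPoch q mu (∑ i, β i)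
  else 0


theorem qPoch_zero (q z : ℂ) : qPoch q z 0 = 1 := by simp [qPoch]

theorem qPoch_add (q z : ℂ) (m k : ℕ) :
    qPoch q z (m + k) = qPoch q z m * qPoch q (z * q ^ m) k := by
  simp only [qPoch, Finset.prod_range_add, pow_add, mul_assoc]

theorem qPoch_succ (q z : ℂ) (m : ℕ) :
    qPoch q z (m + 1) = qPoch q z m * (1 - z * q ^ m) := by
  simp only [qPoch, Finset.prod_range_succ]

theorem qPoch_succ' (q z : ℂ) (m : ℕ) :
    qPoch q z (m + 1) = (1 - z) * qPoch q (z * q) m := by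
  rw [add_comm, qPoch_add]
  simp [qPoch]

theorem qPoch_ne_zero_of_le {q z : ℂ} {m k : ℕ} (hmk : m ≤ k) (h : qPoch q z k ≠ 0) :
    qPoch q z m ≠ 0 := by
  obtain ⟨r, rfl⟩ := Nat.exists_eq_add_of_le hmk
  rw [qPoch_add] at h
  exact left_ne_zero_of_mul h

theorem qPoch_one_eq_zero (q : ℂ) {m : ℕ} (hm : m ≠ 0) : qPoch q 1 m = 0 := by
  obtain ⟨k, rfl⟩ := Nat.exists_eq_succ_of_ne_zero hm
  simp [qPoch_succ']

theorem notRootOfUnity.one_sub_ne_zero {q : ℂ} (hq : notRootOfUnity q) (j : ℕ) :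
    1 - q * q ^ j ≠ 0 := by
  rw [← pow_succ', sub_ne_zero]
  exact (hq (j + 1) j.succ_pos).symm

theorem notRootOfUnity.qPoch_ne_zero {q : ℂ} (hq : notRootOfUnity q) (m : ℕ) :
    qPoch q q m ≠ 0 :=
  Finset.prod_ne_zero_iff.2 fun j _ => hq.one_sub_ne_zero j

theorem qBinom_add_left (q : ℂ) (k r : ℕ) :
    qBinom q (k + r) k = qPoch q q (k + r) / (qPoch q q k * qPoch q q r) := by
  simp [qBinom]

theorem qBinom_of_lt (q : ℂ) {m k : ℕ} (h : m < k) : qBinom q m k = 0 := by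
  simp [qBinom, not_le.2 h]

theorem qBinom_zero_right {q : ℂ} (hq : notRootOfUnity q) (m : ℕ) : qBinom q m 0 = 1 := by
  simp [qBinom, qPoch_zero, hq.qPoch_ne_zero m]

theorem qBinom_self {q : ℂ} (hq : notRootOfUnity q) (m : ℕ) : qBinom q m m = 1 := by
  simp [qBinom, qPoch_zero, hq.qPoch_ne_zero m]

/-- The q-Pascal rule. -/
theorem qBinom_succ_succ {q : ℂ} (hq : notRootOfUnity q) (m k : ℕ) :
    qBinom q (m + 1) (k + 1) = q ^ (k + 1) * qBinom q m (k + 1) + qBinom q m k := by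
  rcases lt_trichotomy m k with h | rfl | h
  · simp [qBinom_of_lt q h, qBinom_of_lt q (Nat.succ_lt_succ h),
      qBinom_of_lt q (h.trans k.lt_succ_self)]
  · simp [qBinom_self hq, qBinom_of_lt q m.lt_succ_self]
  · obtain ⟨r, rfl⟩ := Nat.exists_eq_add_of_lt h
    have e₁ : k + r + 1 + 1 = (k + 1) + (r + 1) := by ring
    have e₂ : k + r + 1 = (k + 1) + r := by ring
    have e₃ : k + 1 + r = k + (r + 1) := by ring
    rw [e₁, e₂, qBinom_add_left, qBinom_add_left, e₃, qBinom_add_left,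
      show k + 1 + (r + 1) = (k + (r + 1)) + 1 by ring]
    simp only [qPoch_succ q q (k + (r + 1)), qPoch_succ q q k, qPoch_succ q q r]
    have h₁ := hq.qPoch_ne_zero k
    have h₂ := hq.qPoch_ne_zero r
    have h₃ := hq.one_sub_ne_zero k
    have h₄ := hq.one_sub_ne_zero r
    field_simp
    ring

theorem qBinom_mul_qBinom {q : ℂ} (hq : notRootOfUnity q) {k d e : ℕ} (hde : d ≤ e) :
    qBinom q (k + e) (k + d) * qBinom q (k + d) k = qBinom q (k + e) k * qBinom q e d := by
  obtain ⟨r, rfl⟩ := Nat.exists_eq_add_of_le hde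
  rw [qBinom_add_left, qBinom_add_left, qBinom_add_left, ← add_assoc, qBinom_add_left]
  have h₁ := hq.qPoch_ne_zero k
  have h₂ := hq.qPoch_ne_zero d
  have h₃ := hq.qPoch_ne_zero r
  have h₄ := hq.qPoch_ne_zero (k + d)
  have h₅ := hq.qPoch_ne_zero (d + r)
  field_simp

/-- The q-Chu–Vandermonde identity. -/
theorem sum_qBinom_mul_qPoch {q : ℂ} (hq : notRootOfUnity q) (m : ℕ) (a b : ℂ) :
    ∑ k ∈ Finset.range (m + 1), qBinom q m k * b ^ k * qPoch q a k * qPoch q b (m - k)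
      = qPoch q (a * b) m := by
  induction m generalizing a b with
  | zero => simp [qPoch_zero, qBinom_self hq]
  | succ m ih =>
    have hb : ∑ k ∈ Finset.range (m + 1),
        q ^ k * qBinom q m k * b ^ k * qPoch q a k * qPoch q b (m + 1 - k)
          = (1 - b) * qPoch q (a * (b * q)) m := by
      rw [← ih, Finset.mul_sum]
      refine Finset.sum_congr rfl fun k hk => ?_
      rw [Nat.sub_add_comm (Finset.mem_range_succ_iff.1 hk), qPoch_succ']
      ring
    have ha : ∑ k ∈ Finset.range (m + 1),
        qBinom q m k * b ^ (k + 1) * qPoch q a (k + 1) * qPoch q b (m - k)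
          = b * (1 - a) * qPoch q (a * q * b) m := by
      rw [← ih, Finset.mul_sum]
      refine Finset.sum_congr rfl fun k _ => ?_
      rw [qPoch_succ']
      ring
    have hb' : ∑ k ∈ Finset.range (m + 1),
        q ^ k * qBinom q m k * b ^ k * qPoch q a k * qPoch q b (m + 1 - k)
          = (∑ k ∈ Finset.range (m + 1), q ^ (k + 1) * qBinom q m (k + 1) * b ^ (k + 1)
              * qPoch q a (k + 1) * qPoch q b (m - k)) + qPoch q b (m + 1) := by
      rw [Finset.sum_range_succ', Finset.sum_range_succ _ m]
      simp [qBinom_of_lt q m.lt_succ_self, qPoch_zero, qBinom_zero_right hq]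
    rw [Finset.sum_range_succ']
    simp only [qBinom_succ_succ hq, Nat.add_sub_add_right, add_mul, Finset.sum_add_distrib,
      qBinom_zero_right hq, qPoch_zero, pow_zero, mul_one, one_mul, Nat.sub_zero]
    rw [add_right_comm, ← hb', hb, ha, qPoch_succ', show a * (b * q) = a * b * q by ring,
      show a * q * b = a * b * q by ring]
    ring

theorem phi_succ {n : ℕ} (β γ : Fin (n + 1) → ℤ) :
    phi β γ = β 0 * ∑ i : Fin n, γ i.succ + phi (Fin.tail β) (Fin.tail γ) := by
  simp [phi, Fin.sum_univ_succ, Fin.tail, Finset.mul_sum]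

theorem phi_add_left {n : ℕ} (α β γ : Fin n → ℤ) :
    phi (α + β) γ = phi α γ + phi β γ := by
  simp only [phi, ← Finset.sum_add_distrib]
  refine Finset.sum_congr rfl fun i _ => Finset.sum_congr rfl fun j _ => ?_
  split_ifs <;> simp [add_mul]

theorem phi_add_right {n : ℕ} (α β γ : Fin n → ℤ) :
    phi α (β + γ) = phi α β + phi α γ := by
  simp only [phi, ← Finset.sum_add_distrib]
  refine Finset.sum_congr rfl fun i _ => Finset.sum_congr rfl fun j _ => ?_
  split_ifs <;> simp [mul_add]

theorem sum_Icc_zero_fin_succ {n : ℕ} (ε : Fin (n + 1) → ℕ) (f : (Fin (n + 1) → ℕ) → ℂ) :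
    ∑ δ ∈ Finset.Icc 0 ε, f δ
      = ∑ d ∈ Finset.range (ε 0 + 1), ∑ δ ∈ Finset.Icc 0 (Fin.tail ε), f (Fin.cons d δ) := by
  rw [← Finset.sum_product']
  refine Finset.sum_nbij' (fun δ => (δ 0, Fin.tail δ)) (fun p => Fin.cons p.1 p.2)
    ?_ ?_ ?_ ?_ ?_
  · intro δ hδ
    simp only [Finset.mem_Icc, zero_le, true_and] at hδ
    simp only [Finset.mem_product, Finset.mem_range_succ_iff, Finset.mem_Icc, zero_le, true_and]
    exact ⟨hδ 0, fun i => hδ i.succ⟩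
  · rintro ⟨d, δ⟩ h
    simp only [Finset.mem_product, Finset.mem_range_succ_iff, Finset.mem_Icc, zero_le,
      true_and] at h
    simp only [Finset.mem_Icc, zero_le, true_and]
    exact Fin.cases h.1 h.2
  · intro δ _
    exact Fin.cons_self_tail δ
  · rintro ⟨d, δ⟩ _
    simp
  · intro δ _
    simp

/-- A multivariate q-Chu–Vandermonde identity. -/
theorem sum_prod_qBinom_mul_qPoch {q : ℂ} (hq0 : q ≠ 0) (hq : notRootOfUnity q) {n : ℕ}
    (ε : Fin n → ℕ) (a b : ℂ) :
    ∑ δ ∈ Finset.Icc 0 ε, q ^ phi (fun i => (ε i : ℤ) - δ i) (fun i => (δ i : ℤ))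
        * (∏ i, qBinom q (ε i) (δ i)) * b ^ (∑ i, δ i) * qPoch q a (∑ i, δ i)
        * qPoch q b (∑ i, ε i - ∑ i, δ i)
      = qPoch q (a * b) (∑ i, ε i) := by
  induction n generalizing a b with
  | zero => simp [phi, qPoch_zero, Finset.Icc_self, Subsingleton.elim ε 0]
  | succ n ih =>
    rw [sum_Icc_zero_fin_succ, Fin.sum_univ_succ, qPoch_add,
      ← sum_qBinom_mul_qPoch hq (ε 0), Finset.sum_mul]
    refine Finset.sum_congr rfl fun d hd => ?_
    obtain ⟨r, hr⟩ := Nat.exists_eq_add_of_le (Finset.mem_range_succ_iff.1 hd)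
    have key := ih (Fin.tail ε) (a * q ^ d) (b * q ^ r)
    rw [show a * q ^ d * (b * q ^ r) = a * b * q ^ (ε 0) by rw [hr, pow_add]; ring] at key
    change _ = qPoch q (a * b * q ^ ε 0) (∑ i : Fin n, ε i.succ) at key
    rw [← key, Finset.mul_sum]
    refine Finset.sum_congr rfl fun δ hδ => ?_
    have hδ' : δ ≤ Fin.tail ε := (Finset.mem_Icc.1 hδ).2
    have hs : ∑ i, δ i ≤ ∑ i, Fin.tail ε i := Finset.sum_le_sum fun i _ => hδ' i
    obtain ⟨t, ht⟩ := Nat.exists_eq_add_of_le hs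
    have ht' : ∑ i : Fin n, ε i.succ = ∑ i, δ i + t := ht
    have hphi : phi (fun i => (ε i : ℤ) - (Fin.cons d δ : Fin (n + 1) → ℕ) i)
          (fun i => ((Fin.cons d δ : Fin (n + 1) → ℕ) i : ℤ))
        = ((r * ∑ i, δ i : ℕ) : ℤ)
          + phi (fun i => (Fin.tail ε i : ℤ) - δ i) (fun i => (δ i : ℤ)) := by
      rw [phi_succ]
      simp only [Fin.cons_zero, Fin.cons_succ, hr]
      push_cast
      rw [add_sub_cancel_left]
      rfl
    rw [hphi, zpow_add₀ hq0, zpow_natCast]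
    simp only [Fin.sum_univ_succ, Fin.prod_univ_succ, Fin.cons_zero, Fin.cons_succ]
    rw [ht, ht', show ε 0 + (∑ i, δ i + t) - (d + ∑ i, δ i) = r + t by omega,
      show ε 0 - d = r by omega, Nat.add_sub_cancel_left, qPoch_add, qPoch_add, mul_pow,
      pow_add, pow_mul]
    simp only [Fin.tail]
    ring

theorem Phi_mul_Phi {n : ℕ} {q lam mu : ℂ} (hq0 : q ≠ 0) (hq : notRootOfUnity q)
    (hlam : lam ≠ 0) (hmu : mu ≠ 0) {κ δ ε : Fin n → ℕ} (hδ : δ ≤ ε)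
    (h : qPoch q lam (∑ i, (κ + δ) i) ≠ 0) :
    Phi n q lam mu (κ + δ) (κ + ε) * Phi n q mu lam κ (κ + δ)
      = q ^ phi (fun i => (ε i : ℤ)) (fun i => (κ i : ℤ)) * (∏ i, qBinom q ((κ + ε) i) (κ i))
          * qPoch q mu (∑ i, κ i) / qPoch q mu (∑ i, (κ + ε) i)
        * (q ^ phi (fun i => (ε i : ℤ) - δ i) (fun i => (δ i : ℤ))
            * (∏ i, qBinom q (ε i) (δ i)) * (mu / lam) ^ (∑ i, δ i)
            * qPoch q (lam / mu) (∑ i, δ i)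
            * qPoch q (mu / lam) (∑ i, ε i - ∑ i, δ i)) := by
  have hphi : q ^ phi (fun i => ((κ + ε) i : ℤ) - ((κ + δ) i : ℤ)) (fun i => ((κ + δ) i : ℤ))
        * q ^ phi (fun i => ((κ + δ) i : ℤ) - (κ i : ℤ)) (fun i => (κ i : ℤ))
      = q ^ phi (fun i => (ε i : ℤ)) (fun i => (κ i : ℤ))
        * q ^ phi (fun i => (ε i : ℤ) - δ i) (fun i => (δ i : ℤ)) := by
    rw [← zpow_add₀ hq0, ← zpow_add₀ hq0]
    congr 1
    have e₁ : (fun i => ((κ + ε) i : ℤ) - ((κ + δ) i : ℤ)) = fun i => (ε i : ℤ) - δ i := by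
      ext i; simp
    have e₂ : (fun i => ((κ + δ) i : ℤ)) = (fun i => (κ i : ℤ)) + fun i => (δ i : ℤ) := by
      ext i; simp
    have e₃ : (fun i => ((κ + δ) i : ℤ) - (κ i : ℤ)) = fun i => (δ i : ℤ) := by
      ext i; simp
    have e₄ : (fun i => (ε i : ℤ)) = (fun i => (ε i : ℤ) - δ i) + fun i => (δ i : ℤ) := by
      ext i; simp
    rw [e₁, e₂, e₃, e₄, phi_add_right, phi_add_left]
    ring
  have hbinom : (∏ i, qBinom q ((κ + ε) i) ((κ + δ) i)) * ∏ i, qBinom q ((κ + δ) i) (κ i)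
      = (∏ i, qBinom q ((κ + ε) i) (κ i)) * ∏ i, qBinom q (ε i) (δ i) := by
    rw [← Finset.prod_mul_distrib, ← Finset.prod_mul_distrib]
    exact Finset.prod_congr rfl fun i _ => qBinom_mul_qBinom hq (hδ i)
  have hpow : (mu / lam) ^ (∑ i, (κ + δ) i) * (lam / mu) ^ (∑ i, κ i)
      = (mu / lam) ^ (∑ i, δ i) := by
    simp only [Pi.add_apply, Finset.sum_add_distrib, pow_add]
    rw [mul_right_comm, ← mul_pow, div_mul_div_cancel₀ hlam, div_self hmu, one_pow, one_mul]
  have hsub : ∑ i, (κ + ε) i - ∑ i, (κ + δ) i = ∑ i, ε i - ∑ i, δ i := by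
    simp only [Pi.add_apply, Finset.sum_add_distrib]
    omega
  have hsub' : ∑ i, (κ + δ) i - ∑ i, κ i = ∑ i, δ i := by
    simp [Finset.sum_add_distrib]
  rw [Phi, Phi, if_pos (add_le_add_right hδ κ), if_pos le_self_add, hsub, hsub']
  calc
    _ = q ^ phi (fun i => ((κ + ε) i : ℤ) - ((κ + δ) i : ℤ)) (fun i => ((κ + δ) i : ℤ))
          * q ^ phi (fun i => ((κ + δ) i : ℤ) - (κ i : ℤ)) (fun i => (κ i : ℤ))
        * ((∏ i, qBinom q ((κ + ε) i) ((κ + δ) i)) * ∏ i, qBinom q ((κ + δ) i) (κ i))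
        * ((mu / lam) ^ (∑ i, (κ + δ) i) * (lam / mu) ^ (∑ i, κ i))
        * (qPoch q lam (∑ i, (κ + δ) i) / qPoch q lam (∑ i, (κ + δ) i))
        * (qPoch q mu (∑ i, κ i) / qPoch q mu (∑ i, (κ + ε) i)
          * qPoch q (lam / mu) (∑ i, δ i) * qPoch q (mu / lam) (∑ i, ε i - ∑ i, δ i)) := by
      ring
    _ = _ := by
      rw [hphi, hbinom, hpow, div_self h]
      ring

/-- Component form of the inversion relation `Š(λ,μ)Š(μ,λ) = id`:
`Σ_{κ ≤ γ ≤ β} Φ_q^{(n)}(γ|β;λ,μ) Φ_q^{(n)}(κ|γ;μ,λ) = δ_{κ,β}`. -/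
theorem inversion_relation (n : ℕ) (hn : 1 ≤ n) (q lam mu : ℂ) (hq0 : q ≠ 0)
    (hq : notRootOfUnity q) (hlam : lam ≠ 0) (hmu : mu ≠ 0)
    (β κ : Fin n → ℕ) (hκ : κ ≤ β)
    (h1 : qPoch q mu (∑ i, β i) ≠ 0) (h2 : qPoch q lam (∑ i, β i) ≠ 0) :
    ∑ γ ∈ Finset.Icc κ β, Phi n q lam mu γ β * Phi n q mu lam κ γ
      = if κ = β then 1 else 0 := by
  obtain ⟨ε, rfl⟩ := exists_add_of_le hκ
  have hsum : ∑ γ ∈ Finset.Icc κ (κ + ε), Phi n q lam mu γ (κ + ε) * Phi n q mu lam κ γ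
      = ∑ δ ∈ Finset.Icc 0 ε, Phi n q lam mu (κ + δ) (κ + ε) * Phi n q mu lam κ (κ + δ) := by
    rw [← Finset.sum_image (g := fun δ => κ + δ)
      (f := fun γ => Phi n q lam mu γ (κ + ε) * Phi n q mu lam κ γ) (by simp),
      Finset.image_add_left_Icc, add_zero]
  have hne : ∀ δ ∈ Finset.Icc 0 ε, qPoch q lam (∑ i, (κ + δ) i) ≠ 0 := fun δ hδ =>
    qPoch_ne_zero_of_le
      (Finset.sum_le_sum fun i _ => Nat.add_le_add_left ((Finset.mem_Icc.1 hδ).2 i) _) h2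
  rw [hsum, Finset.sum_congr rfl fun δ hδ =>
      Phi_mul_Phi hq0 hq hlam hmu (Finset.mem_Icc.1 hδ).2 (hne δ hδ),
    ← Finset.mul_sum, sum_prod_qBinom_mul_qPoch hq0 hq, div_mul_div_cancel₀ hmu,
    div_self hlam]
  by_cases hε : ε = 0
  · subst hε
    rw [add_zero] at h1
    simp [phi, qBinom_self hq, qPoch_zero, div_self h1]
  · have hs : ∑ i, ε i ≠ 0 := fun h0 =>
      hε (funext fun i => Finset.sum_eq_zero_iff.1 h0 i (Finset.mem_univ i))
    rw [qPoch_one_eq_zero q hs, mul_zero, if_neg (by simpa using hε)]
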